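/- arXiv:2212.14123 — 2 statements merged into one kernel-verified Lean document; each statement's English description precedes it below -/
import Mathlib

section
/- For every p ∈ [1,∞) and all measure networks 𝒳 and 𝒴, the infimum defining the Gromov-Wasserstein p-distance is attained: there exists a coupling π ∈ C(μ_X, μ_Y) such that dis_p(π) = GW_p(𝒳,𝒴). -/
open MeasureTheory ENNReal

/-- The support of a Borel measure: points all of whose neighborhoods have positive mass. -/
noncomputable def measSupp {Z : Type} [TopologicalSpace Z] [MeasurableSpace Z] (μ : Measure Z) : Set Z :=
  {z | ∀ U ∈ nhds z, 0 < μ U}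

/-- The `p`-distortion of a coupling `π` between measure networks `(X, ωX, ·)` and `(Y, ωY, ·)`,
for `p ∈ [1,∞]` (the value `p = ∞` is `⊤`). -/
noncomputable def netDis {X Y : Type} [MeasurableSpace X] [MeasurableSpace Y]
    [TopologicalSpace X] [TopologicalSpace Y]
    (ωX : X → X → ℝ) (ωY : Y → Y → ℝ) (p : ℝ≥0∞) (π : Measure (X × Y)) : ℝ≥0∞ :=
  if p = ⊤ then
    ⨆ (a : X × Y) (b : X × Y) (_ : a ∈ measSupp π) (_ : b ∈ measSupp π),
      ENNReal.ofReal |ωX a.1 b.1 - ωY a.2 b.2|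
  else
    (∫⁻ q : (X × Y) × (X × Y),
        ENNReal.ofReal |ωX q.1.1 q.2.1 - ωY q.1.2 q.2.2| ^ p.toReal ∂(π.prod π)) ^ (1 / p.toReal)

/-- The Gromov–Wasserstein `p`-distance between measure networks: the infimum of the
`p`-distortion over all couplings of `μX` and `μY`. -/
noncomputable def netGW {X Y : Type} [MeasurableSpace X] [MeasurableSpace Y]
    [TopologicalSpace X] [TopologicalSpace Y]
    (ωX : X → X → ℝ) (ωY : Y → Y → ℝ) (μX : Measure X) (μY : Measure Y) (p : ℝ≥0∞) : ℝ≥0∞ :=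
  ⨅ (π : Measure (X × Y)) (_ : IsProbabilityMeasure π)
    (_ : π.map Prod.fst = μX ∧ π.map Prod.snd = μY), netDis ωX ωY p π

/-- The Gromov–Monge `p`-distance between measure networks: the infimum of the `p`-distortion
of the couplings induced by measure-preserving maps `φ : X → Y` (`⊤` if there is none). -/
noncomputable def netGM {X Y : Type} [MeasurableSpace X] [MeasurableSpace Y]
    [TopologicalSpace X] [TopologicalSpace Y]
    (ωX : X → X → ℝ) (ωY : Y → Y → ℝ) (μX : Measure X) (μY : Measure Y) (p : ℝ≥0∞) : ℝ≥0∞ :=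
  ⨅ (φ : X → Y) (_ : Measurable φ) (_ : μX.map φ = μY),
    netDis ωX ωY p (μX.map fun x => (x, φ x))

/-- A strong isomorphism between measure networks: a measure-preserving bijection with
measure-preserving inverse which exactly preserves the network functions. -/
def StrongIso {X Y : Type} [MeasurableSpace X] [MeasurableSpace Y]
    (ωX : X → X → ℝ) (ωY : Y → Y → ℝ) (μX : Measure X) (μY : Measure Y) : Prop :=
  ∃ φ : X ≃ Y, Measurable φ ∧ Measurable φ.symm ∧
    μX.map φ = μY ∧ μY.map φ.symm = μX ∧
    ∀ x x' : X, ωY (φ x) (φ x') = ωX x x'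

/-- Weak isomorphism of measure networks: a common Borel probability space mapping
measure-preservingly onto both, intertwining the network functions almost everywhere. -/
def WeakIso {X Y : Type} [MeasurableSpace X] [MeasurableSpace Y]
    (ωX : X → X → ℝ) (ωY : Y → Y → ℝ) (μX : Measure X) (μY : Measure Y) : Prop :=
  ∃ (Z : Type) (_ : MeasurableSpace Z) (μZ : Measure Z), IsProbabilityMeasure μZ ∧
    ∃ (φX : Z → X) (φY : Z → Y), Measurable φX ∧ Measurable φY ∧
      μZ.map φX = μX ∧ μZ.map φY = μY ∧
      ∀ᵐ zz ∂(μZ.prod μZ), ωX (φX zz.1) (φX zz.2) = ωY (φY zz.1) (φY zz.2)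

open Filter Topology TopologicalSpace BoundedContinuousFunction

/-- The set of couplings of two Borel measures, inside the space of probability measures on the
product. -/
def couplingSet {S T : Type*} [MeasurableSpace S] [MeasurableSpace T]
    (ρ : Measure S) (σ : Measure T) : Set (ProbabilityMeasure (S × T)) :=
  {π | (π : Measure (S × T)).map Prod.fst = ρ ∧ (π : Measure (S × T)).map Prod.snd = σ}

section Compactness

variable {S T : Type*} [MeasurableSpace S] [TopologicalSpace S] [PolishSpace S] [BorelSpace S]
  [MeasurableSpace T] [TopologicalSpace T] [PolishSpace T] [BorelSpace T]

theorem isClosed_couplingSet (ρ : Measure S) [IsProbabilityMeasure ρ]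
    (σ : Measure T) [IsProbabilityMeasure σ] : IsClosed (couplingSet ρ σ) := by
  let := upgradeIsCompletelyMetrizable S
  let := upgradeIsCompletelyMetrizable T
  let ρ' : ProbabilityMeasure S := ⟨ρ, inferInstance⟩
  let σ' : ProbabilityMeasure T := ⟨σ, inferInstance⟩
  have h : couplingSet ρ σ =
      {π | π.map continuous_fst.measurable.aemeasurable = ρ'} ∩
      {π | π.map continuous_snd.measurable.aemeasurable = σ'} := by
    ext π
    exact ⟨fun h => ⟨Subtype.ext h.1, Subtype.ext h.2⟩,
      fun h => ⟨congrArg Subtype.val h.1, congrArg Subtype.val h.2⟩⟩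
  rw [h]
  exact (isClosed_eq (ProbabilityMeasure.continuous_map continuous_fst) continuous_const).inter
    (isClosed_eq (ProbabilityMeasure.continuous_map continuous_snd) continuous_const)

theorem isTightMeasureSet_couplingSet (ρ : Measure S) [IsProbabilityMeasure ρ]
    (σ : Measure T) [IsProbabilityMeasure σ] :
    IsTightMeasureSet {((π : ProbabilityMeasure (S × T)) : Measure (S × T)) |
      π ∈ couplingSet ρ σ} := by
  let := upgradeIsCompletelyMetrizable S
  let := upgradeIsCompletelyMetrizable T
  rw [isTightMeasureSet_iff_exists_isCompact_measure_compl_le]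
  intro ε hε
  obtain ⟨K, hK, hKε⟩ := isTightMeasureSet_iff_exists_isCompact_measure_compl_le.1
    (isTightMeasureSet_singleton (μ := ρ)) (ε / 2) (ENNReal.half_pos hε.ne')
  obtain ⟨L, hL, hLε⟩ := isTightMeasureSet_iff_exists_isCompact_measure_compl_le.1
    (isTightMeasureSet_singleton (μ := σ)) (ε / 2) (ENNReal.half_pos hε.ne')
  refine ⟨K ×ˢ L, hK.prod hL, ?_⟩
  rintro _ ⟨π, ⟨h₁, h₂⟩, rfl⟩
  have hsub : (K ×ˢ L)ᶜ ⊆ (Prod.fst ⁻¹' Kᶜ ∪ Prod.snd ⁻¹' Lᶜ : Set (S × T)) := by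
    intro z hz
    by_contra hz'
    simp_all
  calc (π : Measure (S × T)) (K ×ˢ L)ᶜ
      ≤ (π : Measure (S × T)) (Prod.fst ⁻¹' Kᶜ) + (π : Measure (S × T)) (Prod.snd ⁻¹' Lᶜ) :=
        (measure_mono hsub).trans (measure_union_le _ _)
    _ = ρ Kᶜ + σ Lᶜ := by
        rw [← h₁, ← h₂, Measure.map_apply measurable_fst hK.isClosed.measurableSet.compl,
          Measure.map_apply measurable_snd hL.isClosed.measurableSet.compl]
    _ ≤ ε / 2 + ε / 2 := add_le_add (hKε _ rfl) (hLε _ rfl)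
    _ = ε := ENNReal.add_halves ε

theorem isCompact_couplingSet (ρ : Measure S) [IsProbabilityMeasure ρ]
    (σ : Measure T) [IsProbabilityMeasure σ] : IsCompact (couplingSet ρ σ) := by
  rw [← (isClosed_couplingSet ρ σ).closure_eq]
  exact isCompact_closure_of_isTightMeasureSet (isTightMeasureSet_couplingSet ρ σ)

end Compactness

section Auxiliary

variable {S T : Type*} [MeasurableSpace S] [MeasurableSpace T]

theorem eLpNorm_sub_le_of_mem_couplingSet {p : ℝ≥0∞} (hp : 1 ≤ p)
    {ρ : Measure S} {σ : Measure T} {π : ProbabilityMeasure (S × T)} (hπ : π ∈ couplingSet ρ σ)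
    {f f' : S → ℝ} {g g' : T → ℝ} (hf : Measurable f) (hf' : Measurable f')
    (hg : Measurable g) (hg' : Measurable g') :
    eLpNorm (fun z => f z.1 - g z.2) p (π : Measure (S × T)) ≤
      eLpNorm (fun z => f' z.1 - g' z.2) p (π : Measure (S × T)) +
        (eLpNorm (f - f') p ρ + eLpNorm (g - g') p σ) := by
  have h₁ : eLpNorm (f - f') p ρ = eLpNorm ((f - f') ∘ Prod.fst) p (π : Measure (S × T)) := by
    rw [← hπ.1]
    exact eLpNorm_map_measure (hf.sub hf').aestronglyMeasurable measurable_fst.aemeasurable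
  have h₂ : eLpNorm (g - g') p σ = eLpNorm ((g - g') ∘ Prod.snd) p (π : Measure (S × T)) := by
    rw [← hπ.2]
    exact eLpNorm_map_measure (hg.sub hg').aestronglyMeasurable measurable_snd.aemeasurable
  have heq : (fun z : S × T => f z.1 - g z.2) =
      (fun z => f' z.1 - g' z.2) + ((f - f') ∘ Prod.fst - (g - g') ∘ Prod.snd) := by
    ext z
    simp only [Pi.add_apply, Pi.sub_apply, Function.comp_apply]
    ring
  have m₁ : AEStronglyMeasurable ((f - f') ∘ Prod.fst) (π : Measure (S × T)) :=
    ((hf.sub hf').comp measurable_fst).aestronglyMeasurable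
  have m₂ : AEStronglyMeasurable ((g - g') ∘ Prod.snd) (π : Measure (S × T)) :=
    ((hg.sub hg').comp measurable_snd).aestronglyMeasurable
  rw [heq, h₁, h₂]
  refine (eLpNorm_add_le ?_ (m₁.sub m₂) hp).trans (add_le_add le_rfl (eLpNorm_sub_le m₁ m₂ hp))
  exact ((hf'.comp measurable_fst).sub (hg'.comp measurable_snd)).aestronglyMeasurable

theorem abs_clamp_sub_clamp_le (M a b : ℝ) :
    |max (-M) (min M a) - max (-M) (min M b)| ≤ |a - b| :=
  calc |max (-M) (min M a) - max (-M) (min M b)|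
      ≤ max |-M - -M| |min M a - min M b| := abs_max_sub_max_le_max _ _ _ _
    _ ≤ max |-M - -M| (max |M - M| |a - b|) :=
        max_le_max le_rfl (abs_min_sub_min_le_max _ _ _ _)
    _ = |a - b| := by simp

theorem tendsto_clamp (a : ℝ) :
    Tendsto (fun n : ℕ => max (-(n : ℝ)) (min (n : ℝ) a)) atTop (𝓝 a) := by
  obtain ⟨N, hN⟩ := exists_nat_ge |a|
  refine tendsto_const_nhds.congr' ?_
  filter_upwards [eventually_ge_atTop N] with n hn
  have hn' : |a| ≤ n := hN.trans (Nat.cast_le.2 hn)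
  rw [min_eq_right (abs_le.1 hn').2, max_eq_right (abs_le.1 hn').1]

theorem memLp_clamp {p : ℝ≥0∞} {ρ : Measure S} [IsFiniteMeasure ρ] {f : S → ℝ}
    (hf : Measurable f) (n : ℕ) :
    MemLp (fun s => max (-(n : ℝ)) (min (n : ℝ) (f s))) p ρ := by
  refine MemLp.of_bound (by fun_prop) (n : ℝ) (Eventually.of_forall fun s => ?_)
  rw [Real.norm_eq_abs, abs_le]
  have : (0 : ℝ) ≤ n := n.cast_nonneg
  exact ⟨le_max_left _ _, max_le (by linarith) (min_le_left _ _)⟩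

theorem continuous_eLpNorm_boundedContinuous_sub
    [TopologicalSpace S] [OpensMeasurableSpace S] [TopologicalSpace T] [OpensMeasurableSpace T]
    [SecondCountableTopologyEither S T] {p : ℝ≥0∞} (hp : 1 ≤ p) (hp' : p ≠ ⊤)
    (f : S →ᵇ ℝ) (g : T →ᵇ ℝ) :
    Continuous fun π : ProbabilityMeasure (S × T) =>
      eLpNorm (fun z => f z.1 - g z.2) p (π : Measure (S × T)) := by
  have hp0 : p ≠ 0 := (zero_lt_one.trans_le hp).ne'
  have hcont : Continuous fun z : S × T => ‖f z.1 - g z.2‖₊ ^ p.toReal :=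
    NNReal.continuous_rpow_const (ENNReal.toReal_nonneg) |>.comp (by fun_prop)
  have hbound (z : S × T) : ‖f z.1 - g z.2‖₊ ^ p.toReal ≤ (‖f‖₊ + ‖g‖₊) ^ p.toReal := by
    gcongr
    exact (nnnorm_sub_le _ _).trans (add_le_add (f.nnnorm_coe_le_nnnorm _)
      (g.nnnorm_coe_le_nnnorm _))
  let F : S × T →ᵇ NNReal := ⟨⟨_, hcont⟩, ((‖f‖₊ + ‖g‖₊) ^ p.toReal : NNReal), fun z w => by
    rw [NNReal.dist_eq]
    exact abs_sub_le_of_nonneg_of_le (NNReal.coe_nonneg _) (NNReal.coe_le_coe.2 (hbound z))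
      (NNReal.coe_nonneg _) (NNReal.coe_le_coe.2 (hbound w))⟩
  simp_rw [eLpNorm_eq_lintegral_rpow_enorm_toReal hp0 hp']
  refine ENNReal.continuous_rpow_const.comp ?_
  convert ProbabilityMeasure.continuous_lintegral_boundedContinuousFunction F using 4 with π z
  change _ = ((‖f z.1 - g z.2‖₊ ^ p.toReal : NNReal) : ℝ≥0∞)
  rw [ENNReal.coe_rpow_of_nonneg _ ENNReal.toReal_nonneg]
  rfl

end Auxiliary

section Semicontinuity

variable {S T : Type*} [MeasurableSpace S] [TopologicalSpace S] [PolishSpace S] [BorelSpace S]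
  [MeasurableSpace T] [TopologicalSpace T] [PolishSpace T] [BorelSpace T]

theorem lowerSemicontinuousOn_eLpNorm_sub_of_memLp {p : ℝ≥0∞} (hp : 1 ≤ p) (hp' : p ≠ ⊤)
    (ρ : Measure S) [IsProbabilityMeasure ρ] (σ : Measure T) [IsProbabilityMeasure σ]
    {f : S → ℝ} {g : T → ℝ} (hf : Measurable f) (hg : Measurable g)
    (hfp : MemLp f p ρ) (hgp : MemLp g p σ) :
    LowerSemicontinuousOn (fun π : ProbabilityMeasure (S × T) =>
      eLpNorm (fun z => f z.1 - g z.2) p (π : Measure (S × T))) (couplingSet ρ σ) := by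
  let := upgradeIsCompletelyMetrizable S
  let := upgradeIsCompletelyMetrizable T
  intro π hπ y hy
  obtain ⟨δ, hδ, hyδ⟩ : ∃ δ : NNReal, 0 < δ ∧
      y + δ < eLpNorm (fun z => f z.1 - g z.2) p (π : Measure (S × T)) :=
    ENNReal.lt_iff_exists_add_pos_lt.1 hy
  have hε : ((δ / 4 : NNReal) : ℝ≥0∞) ≠ 0 := by positivity
  obtain ⟨f', hf', -⟩ := hfp.exists_boundedContinuous_eLpNorm_sub_le hp' hε
  obtain ⟨g', hg', -⟩ := hgp.exists_boundedContinuous_eLpNorm_sub_le hp' hε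
  have mf' : Measurable f' := f'.continuous.measurable
  have mg' : Measurable g' := g'.continuous.measurable
  have hsum : ((δ / 4 : NNReal) : ℝ≥0∞) + (δ / 4 : NNReal) = (δ / 2 : NNReal) := by
    rw [← ENNReal.coe_add]
    congr 1
    ext
    push_cast
    ring
  have hδ2 : (δ : ℝ≥0∞) = (δ / 2 : NNReal) + (δ / 2 : NNReal) := by
    rw [← ENNReal.coe_add, _root_.add_halves]
  have hπ' : y + (δ / 2 : NNReal) <
      eLpNorm (fun z => f' z.1 - g' z.2) p (π : Measure (S × T)) := by
    have h := (hyδ.trans_le (eLpNorm_sub_le_of_mem_couplingSet hp hπ hf mf' hg mg')).trans_le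
      (add_le_add le_rfl ((add_le_add hf' hg').trans_eq hsum))
    rw [hδ2, ← add_assoc] at h
    exact lt_of_add_lt_add_right h
  have hev :=
    (continuous_eLpNorm_boundedContinuous_sub hp hp' f' g').continuousAt.eventually_const_lt hπ'
  filter_upwards [hev.filter_mono nhdsWithin_le_nhds, self_mem_nhdsWithin] with ν hν hνc
  rw [eLpNorm_sub_comm] at hf' hg'
  have h := (hν.trans_le (eLpNorm_sub_le_of_mem_couplingSet hp hνc mf' hf mg' hg)).trans_le
      (add_le_add le_rfl ((add_le_add hf' hg').trans_eq hsum))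
  exact lt_of_add_lt_add_right h

theorem lowerSemicontinuousOn_eLpNorm_sub {p : ℝ≥0∞} (hp : 1 ≤ p) (hp' : p ≠ ⊤)
    (ρ : Measure S) [IsProbabilityMeasure ρ] (σ : Measure T) [IsProbabilityMeasure σ]
    {f : S → ℝ} {g : T → ℝ} (hf : Measurable f) (hg : Measurable g) :
    LowerSemicontinuousOn (fun π : ProbabilityMeasure (S × T) =>
      eLpNorm (fun z => f z.1 - g z.2) p (π : Measure (S × T))) (couplingSet ρ σ) := by
  intro π hπ y hy
  have hfatou := Lp.eLpNorm_lim_le_liminf_eLpNorm (p := p) (μ := (π : Measure (S × T)))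
    (f := fun (n : ℕ) (z : S × T) =>
      max (-(n : ℝ)) (min (n : ℝ) (f z.1)) - max (-(n : ℝ)) (min (n : ℝ) (g z.2)))
    (fun n => by fun_prop) (fun z => f z.1 - g z.2)
    (Eventually.of_forall fun z => (tendsto_clamp (f z.1)).sub (tendsto_clamp (g z.2)))
  obtain ⟨n, hn⟩ := (eventually_lt_of_lt_liminf (hy.trans_le hfatou)).exists
  filter_upwards [lowerSemicontinuousOn_eLpNorm_sub_of_memLp hp hp' ρ σ
    (f := fun s => max (-(n : ℝ)) (min (n : ℝ) (f s)))
    (g := fun t => max (-(n : ℝ)) (min (n : ℝ) (g t))) (by fun_prop) (by fun_prop)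
    (memLp_clamp hf n) (memLp_clamp hg n) π hπ y hn] with ν hν
  exact hν.trans_le (eLpNorm_mono fun z => abs_clamp_sub_clamp_le _ _ _)

end Semicontinuity

section ProdSelf

variable {X Y : Type*} [MeasurableSpace X] [MeasurableSpace Y]

/-- The self-product of a measure on `X × Y`, seen as a measure on `(X × X) × (Y × Y)`. -/
noncomputable def prodSelfComm (π : ProbabilityMeasure (X × Y)) :
    ProbabilityMeasure ((X × X) × (Y × Y)) :=
  (π.prod π).map (f := fun q => ((q.1.1, q.2.1), (q.1.2, q.2.2))) (by fun_prop)

theorem prodSelfComm_mem_couplingSet {μX : Measure X} [IsProbabilityMeasure μX]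
    {μY : Measure Y} [IsProbabilityMeasure μY]
    {π : ProbabilityMeasure (X × Y)} (hπ : π ∈ couplingSet μX μY) :
    prodSelfComm π ∈ couplingSet (μX.prod μX) (μY.prod μY) := by
  constructor
  · rw [prodSelfComm, ProbabilityMeasure.toMeasure_map, Measure.map_map (by fun_prop) (by fun_prop),
      ProbabilityMeasure.toMeasure_prod]
    conv_rhs => rw [← hπ.1, Measure.map_prod_map _ _ measurable_fst measurable_fst]
    rfl
  · rw [prodSelfComm, ProbabilityMeasure.toMeasure_map, Measure.map_map (by fun_prop) (by fun_prop),
      ProbabilityMeasure.toMeasure_prod]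
    conv_rhs => rw [← hπ.2, Measure.map_prod_map _ _ measurable_snd measurable_snd]
    rfl

theorem netDis_eq_eLpNorm_prodSelfComm {X Y : Type} [MeasurableSpace X] [MeasurableSpace Y]
    [TopologicalSpace X] [TopologicalSpace Y] {ωX : X → X → ℝ} {ωY : Y → Y → ℝ}
    (hωX : Measurable (Function.uncurry ωX)) (hωY : Measurable (Function.uncurry ωY))
    {p : ℝ≥0∞} (hp : p ≠ 0) (hp' : p ≠ ⊤) (π : ProbabilityMeasure (X × Y)) :
    netDis ωX ωY p (π : Measure (X × Y)) =
      eLpNorm (fun z => Function.uncurry ωX z.1 - Function.uncurry ωY z.2) p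
        (prodSelfComm π : Measure ((X × X) × (Y × Y))) := by
  have hmeas : Measurable fun z : (X × X) × (Y × Y) =>
      Function.uncurry ωX z.1 - Function.uncurry ωY z.2 := by fun_prop
  rw [prodSelfComm, ProbabilityMeasure.toMeasure_map,
    eLpNorm_map_measure hmeas.aestronglyMeasurable (by fun_prop),
    eLpNorm_eq_lintegral_rpow_enorm_toReal hp hp', netDis, if_neg hp']
  simp [Function.uncurry, Real.enorm_eq_ofReal_abs]

end ProdSelf

section Distortion

variable {X Y : Type} [MeasurableSpace X] [TopologicalSpace X] [PolishSpace X] [BorelSpace X]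
  [MeasurableSpace Y] [TopologicalSpace Y] [PolishSpace Y] [BorelSpace Y]

theorem continuous_prodSelfComm : Continuous (prodSelfComm (X := X) (Y := Y)) := by
  let := upgradeIsCompletelyMetrizable X
  let := upgradeIsCompletelyMetrizable Y
  exact (ProbabilityMeasure.continuous_map
    (f := fun q : (X × Y) × (X × Y) => ((q.1.1, q.2.1), (q.1.2, q.2.2))) (by fun_prop)).comp
    (ProbabilityMeasure.continuous_prod.comp (continuous_id.prodMk continuous_id))

theorem lowerSemicontinuousOn_netDis {ωX : X → X → ℝ} {ωY : Y → Y → ℝ}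
    (hωX : Measurable (Function.uncurry ωX)) (hωY : Measurable (Function.uncurry ωY))
    (μX : Measure X) [IsProbabilityMeasure μX] (μY : Measure Y) [IsProbabilityMeasure μY]
    {p : ℝ≥0∞} (hp : 1 ≤ p) (hp' : p ≠ ⊤) :
    LowerSemicontinuousOn
      (fun π : ProbabilityMeasure (X × Y) => netDis ωX ωY p (π : Measure (X × Y)))
      (couplingSet μX μY) := by
  simp_rw [netDis_eq_eLpNorm_prodSelfComm hωX hωY (zero_lt_one.trans_le hp).ne' hp']
  exact (lowerSemicontinuousOn_eLpNorm_sub hp hp' (μX.prod μX) (μY.prod μY) hωX hωY).comp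
    continuous_prodSelfComm.continuousOn fun π hπ => prodSelfComm_mem_couplingSet hπ

end Distortion

/-- for `p ∈ [1,∞)` and arbitrary measure networks, the infimum defining the
Gromov–Wasserstein `p`-distance is attained by some coupling. -/
theorem gromovWasserstein_exists_optimal_coupling
    {X Y : Type} [MeasurableSpace X] [TopologicalSpace X] [PolishSpace X] [BorelSpace X]
    [MeasurableSpace Y] [TopologicalSpace Y] [PolishSpace Y] [BorelSpace Y]
    (ωX : X → X → ℝ) (ωY : Y → Y → ℝ)
    (hωX : Measurable (Function.uncurry ωX)) (hωY : Measurable (Function.uncurry ωY))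
    (μX : Measure X) [IsProbabilityMeasure μX] [μX.IsOpenPosMeasure]
    (μY : Measure Y) [IsProbabilityMeasure μY] [μY.IsOpenPosMeasure]
    (p : ℝ≥0∞) (hp : 1 ≤ p) (hp' : p ≠ ⊤) :
    ∃ π : Measure (X × Y), IsProbabilityMeasure π ∧
      π.map Prod.fst = μX ∧ π.map Prod.snd = μY ∧
      netDis ωX ωY p π = netGW ωX ωY μX μY p := by
  have hne : (couplingSet μX μY).Nonempty :=
    ⟨⟨μX.prod μY, inferInstance⟩, Measure.map_fst_prod.trans (by simp),
      Measure.map_snd_prod.trans (by simp)⟩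
  obtain ⟨π, hπ, hmin⟩ := (lowerSemicontinuousOn_netDis hωX hωY μX μY hp hp').exists_isMinOn hne
    (isCompact_couplingSet μX μY)
  refine ⟨π, inferInstance, hπ.1, hπ.2, le_antisymm ?_ ?_⟩
  · exact le_iInf fun ν => le_iInf fun hν => le_iInf fun hc => hmin (a := ⟨ν, hν⟩) hc
  · exact iInf_le_of_le π (iInf_le_of_le inferInstance (iInf_le _ hπ))
end

section
/- Let p ∈ [1,∞) and let 𝒳, 𝒴 be measure networks with finite p-size (i.e., 𝒳, 𝒴 ∈ N_p). If (π_m) is a sequence of couplings in C(μ_X, μ_Y) converging weakly (in the sense of weak convergence of probability measures on X × Y) to a coupling π ∈ C(μ_X, μ_Y), then dis_p(π_m) → dis_p(π) as m → ∞. -/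
open MeasureTheory ENNReal

open Filter Topology
open scoped NNReal BoundedContinuousFunction

theorem netDis_eq_eLpNorm {X Y : Type} [MeasurableSpace X] [MeasurableSpace Y]
    [TopologicalSpace X] [TopologicalSpace Y] (ωX : X → X → ℝ) (ωY : Y → Y → ℝ)
    {p : ℝ≥0∞} (hp : p ≠ 0) (hp' : p ≠ ⊤) (π : Measure (X × Y)) :
    netDis ωX ωY p π =
      eLpNorm (fun q : (X × Y) × (X × Y) => ωX q.1.1 q.2.1 - ωY q.1.2 q.2.2) p (π.prod π) := by
  simp only [netDis, if_neg hp', eLpNorm_eq_lintegral_rpow_enorm_toReal hp hp',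
    Real.enorm_eq_ofReal_abs]

/-- The `p`-norm of a bounded continuous function depends continuously on the probability
measure. -/
theorem BoundedContinuousFunction.tendsto_eLpNorm {Z ι : Type*} [TopologicalSpace Z]
    [MeasurableSpace Z] [OpensMeasurableSpace Z] {l : Filter ι} {μs : ι → ProbabilityMeasure Z}
    {μ : ProbabilityMeasure Z} (hμ : Tendsto μs l (𝓝 μ)) (f : Z →ᵇ ℝ)
    {p : ℝ≥0∞} (hp : p ≠ 0) (hp' : p ≠ ⊤) :
    Tendsto (fun i => eLpNorm f p (μs i : Measure Z)) l (𝓝 (eLpNorm f p (μ : Measure Z))) := by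
  have hcont : Continuous fun z => ‖f z‖₊ ^ p.toReal :=
    (NNReal.continuous_rpow_const toReal_nonneg).comp f.continuous.nnnorm
  have hbdd : Bornology.IsBounded (Set.range fun z => ‖f z‖₊ ^ p.toReal) :=
    (Metric.isBounded_Icc 0 (‖f‖₊ ^ p.toReal)).subset <| Set.range_subset_iff.2 fun z =>
      ⟨zero_le, NNReal.rpow_le_rpow (f.nnnorm_coe_le_nnnorm z) toReal_nonneg⟩
  have h := ProbabilityMeasure.tendsto_iff_forall_lintegral_tendsto.1 hμ
    ⟨⟨_, hcont⟩, Metric.isBounded_range_iff.1 hbdd⟩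
  simp only [eLpNorm_eq_lintegral_rpow_enorm_toReal hp hp']
  refine (ENNReal.continuous_rpow_const.tendsto _).comp ?_
  simpa [enorm_eq_nnnorm, ENNReal.coe_rpow_of_nonneg] using h

/-- The `p`-distortion of a coupling varies with the network functions by at most their
`p`-distances. -/
theorem netDis_le_add {X Y : Type} [MeasurableSpace X] [MeasurableSpace Y]
    [TopologicalSpace X] [TopologicalSpace Y] {μX : Measure X} {μY : Measure Y}
    {ωX ωX' : X → X → ℝ} {ωY ωY' : Y → Y → ℝ}
    (hωX : Measurable (Function.uncurry ωX)) (hωX' : Measurable (Function.uncurry ωX'))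
    (hωY : Measurable (Function.uncurry ωY)) (hωY' : Measurable (Function.uncurry ωY'))
    {p : ℝ≥0∞} (hp : 1 ≤ p) (hp' : p ≠ ⊤) (π : Measure (X × Y)) [SFinite π]
    (hπ : π.map Prod.fst = μX ∧ π.map Prod.snd = μY) :
    netDis ωX ωY p π ≤ netDis ωX' ωY' p π +
      (eLpNorm (Function.uncurry ωX - Function.uncurry ωX') p (μX.prod μX) +
        eLpNorm (Function.uncurry ωY - Function.uncurry ωY') p (μY.prod μY)) := by
  obtain ⟨rfl, rfl⟩ := hπ
  have hp0 : p ≠ 0 := (zero_lt_one.trans_le hp).ne'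
  have hA : MeasurePreserving (Prod.fst : X × Y → X) π (π.map Prod.fst) := ⟨measurable_fst, rfl⟩
  have hB : MeasurePreserving (Prod.snd : X × Y → Y) π (π.map Prod.snd) := ⟨measurable_snd, rfl⟩
  have hA₂ := hA.prod hA
  have hB₂ := hB.prod hB
  rw [netDis_eq_eLpNorm _ _ hp0 hp', netDis_eq_eLpNorm _ _ hp0 hp',
    ← eLpNorm_comp_measurePreserving (hωX.sub hωX').aestronglyMeasurable hA₂,
    ← eLpNorm_comp_measurePreserving (hωY.sub hωY').aestronglyMeasurable hB₂]
  have h₁ := (hωX.sub hωX').comp hA₂.measurable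
  have h₂ := (hωY.sub hωY').comp hB₂.measurable
  have h₃ := (hωX'.comp hA₂.measurable).sub (hωY'.comp hB₂.measurable)
  calc _ = eLpNorm ((Function.uncurry ωX' ∘ Prod.map Prod.fst Prod.fst -
          Function.uncurry ωY' ∘ Prod.map Prod.snd Prod.snd) +
        ((Function.uncurry ωX - Function.uncurry ωX') ∘ Prod.map Prod.fst Prod.fst -
        (Function.uncurry ωY - Function.uncurry ωY') ∘ Prod.map Prod.snd Prod.snd))
          p (π.prod π) := by
        congr 1
        ext q
        simp [Function.uncurry]
        ring
    _ ≤ _ := (eLpNorm_add_le h₃.aestronglyMeasurable (h₁.sub h₂).aestronglyMeasurable hp).trans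
        (add_le_add le_rfl
          (eLpNorm_sub_le h₁.aestronglyMeasurable h₂.aestronglyMeasurable hp))

theorem memLp_uncurry_of_lintegral_ne_top {Z : Type*} [MeasurableSpace Z] {ω : Z → Z → ℝ}
    (hω : Measurable (Function.uncurry ω)) {μ : Measure Z} {p : ℝ≥0∞} (hp : p ≠ 0) (hp' : p ≠ ⊤)
    (hsize : (∫⁻ q : Z × Z, ENNReal.ofReal |ω q.1 q.2| ^ p.toReal ∂(μ.prod μ)) ≠ ⊤) :
    MemLp (Function.uncurry ω) p (μ.prod μ) := by
  refine ⟨hω.aestronglyMeasurable, ?_⟩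
  rw [eLpNorm_lt_top_iff_lintegral_rpow_enorm_lt_top hp hp']
  simpa only [Real.enorm_eq_ofReal_abs, Function.uncurry_def] using hsize.lt_top

theorem ENNReal.tendsto_of_forall_approx {ι : Type*} {l : Filter ι} {u : ι → ℝ≥0∞} {a : ℝ≥0∞}
    (ha : a ≠ ⊤)
    (h : ∀ ε : ℝ≥0, ε ≠ 0 → ∃ v : ι → ℝ≥0∞, ∃ b, Tendsto v l (𝓝 b) ∧ a ≤ b + ε ∧ b ≤ a + ε ∧
      ∀ i, u i ≤ v i + ε ∧ v i ≤ u i + ε) :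
    Tendsto u l (𝓝 a) := by
  refine (ENNReal.tendsto_nhds ha).2 fun δ hδ => ?_
  obtain ⟨ε, hε, hεδ⟩ := ENNReal.lt_iff_exists_nnreal_btwn.1 (ENNReal.div_pos hδ.ne' ofNat_ne_top :
    0 < δ / 3)
  have hδ' : (ε : ℝ≥0∞) + ε + ε ≤ δ := by
    rw [← ENNReal.add_thirds δ]
    gcongr
  obtain ⟨v, b, hv, hab, hba, huv⟩ := h ε (by exact_mod_cast hε.ne')
  have hb : b ≠ ⊤ := ne_top_of_le_ne_top (ENNReal.add_ne_top.2 ⟨ha, coe_ne_top⟩) hba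
  filter_upwards [(ENNReal.tendsto_nhds hb).1 hv ε hε] with i hi
  refine ⟨tsub_le_iff_right.2 ?_, ?_⟩
  · calc a ≤ b + ε := hab
      _ ≤ v i + ε + ε := by gcongr; exact tsub_le_iff_right.1 hi.1
      _ ≤ u i + ε + ε + ε := by gcongr; exact (huv i).2
      _ = u i + (ε + ε + ε) := by ring
      _ ≤ u i + δ := by gcongr
  · calc u i ≤ v i + ε := (huv i).1
      _ ≤ b + ε + ε := by gcongr; exact hi.2
      _ ≤ a + ε + ε + ε := by gcongr
      _ = a + (ε + ε + ε) := by ring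
      _ ≤ a + δ := by gcongr

/-- for measure networks of finite `p`-size (`p ∈ [1,∞)`), the `p`-distortion
is continuous along weakly convergent sequences of couplings. -/
theorem netDis_continuous_of_weak_convergence
    {X Y : Type} [MeasurableSpace X] [TopologicalSpace X] [PolishSpace X] [BorelSpace X]
    [MeasurableSpace Y] [TopologicalSpace Y] [PolishSpace Y] [BorelSpace Y]
    (ωX : X → X → ℝ) (ωY : Y → Y → ℝ)
    (hωX : Measurable (Function.uncurry ωX)) (hωY : Measurable (Function.uncurry ωY))
    (μX : Measure X) [IsProbabilityMeasure μX] [μX.IsOpenPosMeasure]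
    (μY : Measure Y) [IsProbabilityMeasure μY] [μY.IsOpenPosMeasure]
    (p : ℝ≥0∞) (hp : 1 ≤ p) (hp' : p ≠ ⊤)
    (hsizeX : (∫⁻ q : X × X, ENNReal.ofReal |ωX q.1 q.2| ^ p.toReal ∂(μX.prod μX)) ≠ ⊤)
    (hsizeY : (∫⁻ q : Y × Y, ENNReal.ofReal |ωY q.1 q.2| ^ p.toReal ∂(μY.prod μY)) ≠ ⊤)
    (πm : ℕ → ProbabilityMeasure (X × Y)) (π : ProbabilityMeasure (X × Y))
    (hπm : ∀ m, (πm m : Measure (X × Y)).map Prod.fst = μX ∧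
                (πm m : Measure (X × Y)).map Prod.snd = μY)
    (hπ : (π : Measure (X × Y)).map Prod.fst = μX ∧ (π : Measure (X × Y)).map Prod.snd = μY)
    (hconv : Filter.Tendsto πm Filter.atTop (nhds π)) :
    Filter.Tendsto (fun m => netDis ωX ωY p (πm m : Measure (X × Y))) Filter.atTop
      (nhds (netDis ωX ωY p (π : Measure (X × Y)))) := by
  have hp0 : p ≠ 0 := (zero_lt_one.trans_le hp).ne'
  have hLX := memLp_uncurry_of_lintegral_ne_top hωX hp0 hp' hsizeX
  have hLY := memLp_uncurry_of_lintegral_ne_top hωY hp0 hp' hsizeY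
  have hfin : netDis ωX ωY p (π : Measure (X × Y)) ≠ ⊤ := by
    have hzero : netDis (fun _ _ : X => 0) (fun _ _ : Y => 0) p (π : Measure (X × Y)) = 0 := by
      simp [netDis_eq_eLpNorm _ _ hp0 hp']
    have h := netDis_le_add hωX (ωX' := fun _ _ => 0) measurable_const hωY (ωY' := fun _ _ => 0)
      measurable_const hp hp' (π : Measure (X × Y)) hπ
    rw [hzero, zero_add] at h
    refine ne_top_of_le_ne_top (ENNReal.add_ne_top.2 ⟨?_, ?_⟩) h
    · exact (hLX.sub (MemLp.zero' : MemLp (fun _ => (0 : ℝ)) p _)).eLpNorm_ne_top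
    · exact (hLY.sub (MemLp.zero' : MemLp (fun _ => (0 : ℝ)) p _)).eLpNorm_ne_top
  refine ENNReal.tendsto_of_forall_approx hfin fun ε hε => ?_
  have hε2 : ((ε / 2 : ℝ≥0) : ℝ≥0∞) ≠ 0 := by simpa using hε
  obtain ⟨f, hf, -⟩ := hLX.exists_boundedContinuous_eLpNorm_sub_le hp' hε2
  obtain ⟨g, hg, -⟩ := hLY.exists_boundedContinuous_eLpNorm_sub_le hp' hε2
  have hsum : ((ε / 2 : ℝ≥0) : ℝ≥0∞) + (ε / 2 : ℝ≥0) = ε := by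
    rw [← ENNReal.coe_add, add_halves]
  have hfm : Measurable (Function.uncurry (Function.curry f)) := f.continuous.measurable
  have hgm : Measurable (Function.uncurry (Function.curry g)) := g.continuous.measurable
  have hle : ∀ ρ : ProbabilityMeasure (X × Y), (ρ : Measure (X × Y)).map Prod.fst = μX ∧
      (ρ : Measure (X × Y)).map Prod.snd = μY →
      netDis ωX ωY p (ρ : Measure (X × Y)) ≤
        netDis (Function.curry f) (Function.curry g) p (ρ : Measure (X × Y)) + ε ∧
      netDis (Function.curry f) (Function.curry g) p (ρ : Measure (X × Y)) ≤
        netDis ωX ωY p (ρ : Measure (X × Y)) + ε := by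
    intro ρ hρ
    refine ⟨(netDis_le_add hωX hfm hωY hgm hp hp' _ hρ).trans ?_,
      (netDis_le_add hfm hωX hgm hωY hp hp' _ hρ).trans ?_⟩
    · rw [← hsum]
      gcongr <;> simpa only [Function.uncurry_curry]
    · rw [← hsum, eLpNorm_sub_comm, eLpNorm_sub_comm (Function.uncurry (Function.curry g))]
      gcongr <;> simpa only [Function.uncurry_curry]
  refine ⟨_, _, ?_, (hle π hπ).1, (hle π hπ).2, fun m => hle (πm m) (hπm m)⟩
  simp only [netDis_eq_eLpNorm _ _ hp0 hp']
  have hprod : Tendsto (fun m => (πm m).prod (πm m)) atTop (𝓝 (π.prod π)) :=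
    (ProbabilityMeasure.continuous_prod.tendsto (π, π)).comp (hconv.prodMk_nhds hconv)
  exact BoundedContinuousFunction.tendsto_eLpNorm hprod
    (f.compContinuous ⟨fun q : (X × Y) × (X × Y) => (q.1.1, q.2.1), by fun_prop⟩ -
      g.compContinuous ⟨fun q : (X × Y) × (X × Y) => (q.1.2, q.2.2), by fun_prop⟩) hp0 hp'
end
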